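/- For every even d ≥ 2, any d-regular triangle-free factor-critical graph G satisfies ν(G) ≥ ⌊5d/4⌋. -/

import Mathlib

/-- The matching number of a simple graph: the largest size of a matching. -/
noncomputable def matchingNumber {V : Type*} (G : SimpleGraph V) : ℕ :=
  sSup {n | ∃ M : G.Subgraph, M.IsMatching ∧ M.edgeSet.ncard = n}

/-- A graph is factor-critical if deleting any vertex leaves a graph with a
perfect matching. -/
def FactorCritical {V : Type*} (G : SimpleGraph V) : Prop :=
  ∀ v : V, ∃ M : (G.induce {u | u ≠ v}).Subgraph, M.IsPerfectMatching

/-- A perfect matching has half as many edges as there are vertices. -/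
theorem SimpleGraph.Subgraph.IsPerfectMatching.two_mul_ncard_edgeSet {V : Type*} [Fintype V]
    {G : SimpleGraph V} {M : G.Subgraph} (hM : M.IsPerfectMatching) :
    2 * M.edgeSet.ncard = Fintype.card V := by
  classical
  have hsum := M.spanningCoe.sum_degrees_eq_twice_card_edges
  have hdeg : ∀ v, M.spanningCoe.degree v = 1 := by
    intro v
    rw [SimpleGraph.Subgraph.degree_spanningCoe]
    exact SimpleGraph.Subgraph.isPerfectMatching_iff_forall_degree.mp hM v
  simp only [hdeg, Finset.sum_const, Finset.card_univ, smul_eq_mul, mul_one] at hsum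
  rw [hsum, ← SimpleGraph.Subgraph.edgeSet_spanningCoe, ← SimpleGraph.coe_edgeFinset,
    Set.ncard_coe_finset]

/-- A regular bipartite graph of positive degree has an even number of vertices. -/
theorem SimpleGraph.IsRegularOfDegree.even_card_of_colorable_two {V : Type*} [Fintype V]
    {G : SimpleGraph V} [DecidableRel G.Adj] {d : ℕ} (hreg : G.IsRegularOfDegree d)
    (hd : 0 < d) (hcol : G.Colorable 2) : Even (Fintype.card V) := by
  classical
  obtain ⟨C⟩ := hcol
  let s : Finset V := {v | C v = 0}
  have hbip : G.IsBipartiteWith (s : Set V) ((sᶜ : Finset V) : Set V) := by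
    refine ⟨by simpa using disjoint_compl_right, fun v w hvw ↦ ?_⟩
    have hne := C.valid hvw
    simp only [s, Finset.coe_compl, Finset.coe_filter, Finset.mem_univ, true_and,
      Set.mem_ofPred_eq, Set.mem_compl_iff]
    lia
  have hsum := SimpleGraph.isBipartiteWith_sum_degrees_eq hbip
  simp only [hreg.degree_eq, Finset.sum_const, smul_eq_mul] at hsum
  have hcard := Nat.eq_of_mul_eq_mul_right hd hsum
  rw [← Finset.card_add_card_compl s, ← hcard]
  exact ⟨_, rfl⟩

/-- In a finite graph every matching is at most as large as the matching number. -/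
theorem SimpleGraph.Subgraph.IsMatching.ncard_edgeSet_le_matchingNumber {V : Type*} [Finite V]
    {G : SimpleGraph V} {M : G.Subgraph} (hM : M.IsMatching) :
    M.edgeSet.ncard ≤ matchingNumber G := by
  refine le_csSup ⟨G.edgeSet.ncard, ?_⟩ ⟨M, hM, rfl⟩
  rintro _ ⟨N, -, rfl⟩
  exact Set.ncard_le_ncard N.edgeSet_subset (Set.toFinite _)

/-- A factor-critical graph has an odd number of vertices, all but one of which can be matched. -/
theorem FactorCritical.exists_card_eq {V : Type*} [Fintype V] [Nonempty V]
    {G : SimpleGraph V} (hfc : FactorCritical G) :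
    ∃ m ≤ matchingNumber G, Fintype.card V = 2 * m + 1 := by
  classical
  obtain ⟨v⟩ := ‹Nonempty V›
  obtain ⟨M, hM⟩ := hfc v
  let f := SimpleGraph.Embedding.induce (G := G) {u | u ≠ v}
  have hmap := (hM.1.map f.toHom f.injective).ncard_edgeSet_le_matchingNumber
  rw [SimpleGraph.Subgraph.edgeSet_map,
    Set.ncard_image_of_injective _ (Sym2.map.injective (f := f.toHom) f.injective)] at hmap
  refine ⟨_, hmap, ?_⟩
  rw [hM.two_mul_ncard_edgeSet]
  have hcard : Fintype.card ({u | u ≠ v} : Set V) = Fintype.card V - 1 :=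
    Set.card_ne_eq v
  have hpos : 0 < Fintype.card V := Fintype.card_pos_iff.mpr ⟨v⟩
  lia

theorem stmt5 {V : Type*} [Fintype V] [Nonempty V] (G : SimpleGraph V)
    [DecidableRel G.Adj] (d : ℕ) (hd2 : 2 ≤ d) (hdeven : Even d)
    (hreg : G.IsRegularOfDegree d) (htf : G.CliqueFree 3)
    (hfc : FactorCritical G) :
    5 * d / 4 ≤ matchingNumber G := by
  obtain ⟨m, hm, hcard⟩ := hfc.exists_card_eq
  have hncol : ¬ G.Colorable 2 := fun hcol ↦ by
    have := hreg.even_card_of_colorable_two (by lia) hcol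
    grind
  have hdeg : d ≤ 2 * Fintype.card V / 5 := by
    by_contra! hlt
    refine hncol (SimpleGraph.colorable_of_cliqueFree_lt_minDegree htf ?_)
    rw [hreg.minDegree_eq]
    simpa [Nat.card_eq_fintype_card] using hlt
  obtain ⟨k, rfl⟩ := hdeven
  lia
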